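/- arXiv:1702.07848 — 7 statements merged into one kernel-verified Lean document; each statement's English description precedes it below -/
import Mathlib

section
/- Let O be a local commutative ring in which 2 is invertible, L a finite free self-dual quadratic O-module with quadratic form q, and ξ ∈ L an O-generator of an isotropic line. Let K := {c ∈ C(L) : ξ·c = 0} be the kernel of left multiplication by ξ on the Clifford algebra C(L). Then for any v ∈ L, left multiplication by v on C(L) preserves K if and only if ⟨v, ξ⟩ = 0. -/
/-- If 2 is invertible, the canonical map to the Clifford algebra is injective. -/
theorem CliffordAlgebra.ι_injective_of_invertible_two {R M : Type*} [CommRing R]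
    [Invertible (2 : R)] [AddCommGroup M] [Module R M] (Q : QuadraticForm R M) :
    Function.Injective (CliffordAlgebra.ι Q) := by
  intro x y h
  have h' := congrArg
    (CliffordAlgebra.changeForm (CliffordAlgebra.changeForm.associated_neg_proof (Q := Q))) h
  rw [CliffordAlgebra.changeForm_ι, CliffordAlgebra.changeForm_ι] at h'
  exact ExteriorAlgebra.ι_leftInverse.injective h'

/-- Let `O` be a local commutative ring in which 2 is invertible, `L` a finite free self-dual
quadratic `O`-module with quadratic form `Q`, and `ξ ∈ L` an `O`-generator of an isotropic
line (i.e. `Q ξ = 0`, `a ↦ a • ξ` is injective, and `span {ξ}` is a direct summand of `L`).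
Let `K := {c ∈ C(L) : ξ·c = 0}` be the kernel of left multiplication by `ξ` on the Clifford
algebra `C(L)`.  Then for `v ∈ L`, left multiplication by `v` preserves `K` iff `⟨v, ξ⟩ = 0`,
where `⟨·,·⟩` is the symmetric bilinear form associated to `Q` (half of the polar form). -/
theorem stmt_0 {O L : Type*} [CommRing O] [IsLocalRing O] [Invertible (2 : O)]
    [AddCommGroup L] [Module O L] [Module.Free O L] [Module.Finite O L]
    (Q : QuadraticForm O L)
    (hselfdual : Function.Bijective
      (QuadraticMap.associated (R := O) Q : L → L →ₗ[O] O))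
    (ξ : L) (hiso : Q ξ = 0)
    (hgen : Function.Injective (LinearMap.toSpanSingleton O L ξ))
    (hsummand : ∃ N : Submodule O L, IsCompl (Submodule.span O {ξ}) N)
    (v : L) :
    (∀ c : CliffordAlgebra Q, CliffordAlgebra.ι Q ξ * c = 0 →
        CliffordAlgebra.ι Q ξ * (CliffordAlgebra.ι Q v * c) = 0) ↔
      QuadraticMap.associated (R := O) Q v ξ = 0 := by
  have hswap : ∀ c : CliffordAlgebra Q, CliffordAlgebra.ι Q ξ * c = 0 →
      CliffordAlgebra.ι Q ξ * (CliffordAlgebra.ι Q v * c) =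
        (2 * QuadraticMap.associated (R := O) Q v ξ) • c := by
    intro c hc
    have hpolar : 2 * QuadraticMap.associated (R := O) Q v ξ = QuadraticMap.polar Q ξ v := by
      rw [QuadraticMap.polar_comm, ← QuadraticMap.polarBilin_apply_apply,
        ← QuadraticMap.two_nsmul_associated O Q, LinearMap.smul_apply, LinearMap.smul_apply,
        nsmul_eq_mul, Nat.cast_ofNat]
    rw [hpolar, Algebra.smul_def, ← CliffordAlgebra.ι_mul_ι_add_swap, add_mul, mul_assoc,
      mul_assoc, hc, mul_zero, add_zero]
  constructor
  · intro h
    have hξ : CliffordAlgebra.ι Q ξ * CliffordAlgebra.ι Q ξ = 0 := by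
      rw [CliffordAlgebra.ι_sq_scalar, hiso, map_zero]
    have h0 := h _ hξ
    rw [hswap _ hξ, ← map_smul] at h0
    have h1 := CliffordAlgebra.ι_injective_of_invertible_two Q (h0.trans (map_zero _).symm)
    have h2 : 2 * QuadraticMap.associated (R := O) Q v ξ = 0 := by
      apply hgen
      simpa only [LinearMap.toSpanSingleton_apply, zero_smul] using h1
    exact (isUnit_of_invertible (2 : O)).mul_right_eq_zero.mp h2
  · intro h c hc
    rw [hswap c hc, h, mul_zero, zero_smul]
end

section
/- Let k be a field of characteristic ≠ 2, d ≥ 1, and Ω a 2d-dimensional k-vector space with a nondegenerate symmetric bilinear form ⟨·,·⟩. Let L, M ⊆ Ω be totally isotropic subspaces of dimension d with Ω = L ⊕ M, let H ⊆ L be a subspace of dimension d−1, and set M₀ := {m ∈ M : ⟨m, h⟩ = 0 for all h ∈ H}. Then dim_k M₀ = 1, and the restriction map ψ ↦ ψ|_H is a bijection from the set of anti-symmetric linear maps ψ : L → M satisfying ψ(H) ⊆ M₀ onto Hom_k(H, M₀). -/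
/-- The orthogonal complement `{v | ⟨v, u⟩ = 0 for all u ∈ U}` of a submodule `U`
with respect to a bilinear form `B`. -/
def perpBilin {k V : Type*} [Field k] [AddCommGroup V] [Module k V]
    (B : LinearMap.BilinForm k V) (U : Submodule k V) : Submodule k V where
  carrier := {v | ∀ u ∈ U, B v u = 0}
  add_mem' := by
    intro a b ha hb u hu
    rw [map_add, LinearMap.add_apply, ha u hu, hb u hu, add_zero]
  zero_mem' := by
    intro u hu
    simp
  smul_mem' := by
    intro c a ha u hu
    rw [LinearMap.map_smul, LinearMap.smul_apply, ha u hu, smul_zero]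

/-- A hyperplane is the kernel of a linear functional taking the value `1` somewhere. -/
theorem Submodule.exists_dual_ker_eq_of_finrank_add_one {k V : Type*} [Field k] [AddCommGroup V]
    [Module k V] [FiniteDimensional k V] (K : Submodule k V)
    (hK : Module.finrank k K + 1 = Module.finrank k V) :
    ∃ (f : Module.Dual k V) (v : V), f v = 1 ∧ LinearMap.ker f = K := by
  have hlt : K < ⊤ := by
    refine lt_top_iff_ne_top.2 fun h => ?_
    rw [h, finrank_top] at hK
    omega
  obtain ⟨f, hf, hle⟩ := K.exists_le_ker_of_lt_top hlt
  have hker := Module.Dual.finrank_ker_add_one_of_ne_zero hf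
  obtain ⟨v, hv⟩ := LinearMap.surjective hf 1
  exact ⟨f, v, hv, (Submodule.eq_of_le_of_finrank_eq hle (by omega)).symm⟩

/-- A nondegenerate bilinear form identifies a totally isotropic subspace `M` with the dual of
any complement `L` of the same dimension. -/
theorem LinearMap.BilinForm.bijective_restrict_of_isCompl {k Ω : Type*} [Field k]
    [AddCommGroup Ω] [Module k Ω] [FiniteDimensional k Ω] {B : LinearMap.BilinForm k Ω}
    (hnondeg : B.Nondegenerate) {L M : Submodule k Ω}
    (hMiso : ∀ x ∈ M, ∀ y ∈ M, B x y = 0)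
    (hdim : Module.finrank k M = Module.finrank k L) (hcompl : IsCompl L M) :
    Function.Bijective (B.domRestrict₁₂ M L) := by
  have hinj : Function.Injective (B.domRestrict₁₂ M L) := by
    refine (injective_iff_map_eq_zero _).2 fun m hm => ?_
    refine Subtype.ext (hnondeg.1 m fun z => ?_)
    obtain ⟨x, hx, y, hy, rfl⟩ := Submodule.mem_sup.1
      (hcompl.sup_eq_top ▸ Submodule.mem_top : z ∈ L ⊔ M)
    have hmx : B m x = 0 := LinearMap.congr_fun hm ⟨x, hx⟩
    rw [map_add, hmx, hMiso m m.2 y hy, add_zero]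
  have hdual : Module.finrank k M = Module.finrank k (Module.Dual k L) := by
    rw [hdim, Subspace.dual_finrank_eq]
  exact ⟨hinj, (LinearMap.injective_iff_surjective_of_finrank_eq_finrank hdual).1 hinj⟩

/-- Let `k` be a field of characteristic `≠ 2`, `d ≥ 1`, and `Ω` a `2d`-dimensional `k`-vector
space with a nondegenerate symmetric bilinear form.  Let `L, M ⊆ Ω` be totally isotropic
subspaces of dimension `d` with `Ω = L ⊕ M`, let `H ⊆ L` have dimension `d−1`, and set
`M₀ := {m ∈ M : ⟨m, h⟩ = 0 for all h ∈ H}`.  Then `dim M₀ = 1`, and restriction to `H` is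
a bijection from the set of anti-symmetric linear maps `ψ : L → M` with `ψ(H) ⊆ M₀` onto
`Hom_k(H, M₀)`. -/
theorem stmt_5 {k Ω : Type*} [Field k] [AddCommGroup Ω] [Module k Ω]
    [FiniteDimensional k Ω]
    (hchar : (2 : k) ≠ 0) (d : ℕ) (hd : 1 ≤ d) (hΩ : Module.finrank k Ω = 2 * d)
    (B : LinearMap.BilinForm k Ω) (hsymm : ∀ x y : Ω, B x y = B y x)
    (hnondeg : B.Nondegenerate)
    (L M : Submodule k Ω)
    (hLiso : ∀ x ∈ L, ∀ y ∈ L, B x y = 0) (hMiso : ∀ x ∈ M, ∀ y ∈ M, B x y = 0)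
    (hL : Module.finrank k L = d) (hM : Module.finrank k M = d)
    (hcompl : IsCompl L M)
    (H : Submodule k Ω) (hHL : H ≤ L) (hH : Module.finrank k H = d - 1) :
    Module.finrank k (M ⊓ perpBilin B H : Submodule k Ω) = 1 ∧
      Function.Bijective
        (fun ψ : {ψ : L →ₗ[k] Ω //
            (∀ x : L, ψ x ∈ M) ∧
            (∀ x y : L, B (x : Ω) (ψ y) = - B (y : Ω) (ψ x)) ∧
            (∀ x : H, ψ (Submodule.inclusion hHL x) ∈ M ⊓ perpBilin B H)} =>
          LinearMap.codRestrict (M ⊓ perpBilin B H)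
            (ψ.1 ∘ₗ Submodule.inclusion hHL) (fun x => ψ.2.2.2 x)) := by
  have hHfin : Module.finrank k (H.comap L.subtype) = d - 1 := by
    rw [← hH, (Submodule.comapSubtypeEquivOfLe hHL).finrank_eq]
  let e : M ≃ₗ[k] Module.Dual k L := LinearEquiv.ofBijective (B.domRestrict₁₂ M L)
    (LinearMap.BilinForm.bijective_restrict_of_isCompl hnondeg hMiso (hM.trans hL.symm) hcompl)
  have he : ∀ (m : M) (x : L), e m x = B x m := fun m x => hsymm m x
  obtain ⟨f, v, hfv, hker⟩ :=
    (H.comap L.subtype).exists_dual_ker_eq_of_finrank_add_one (by omega)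
  have hmem : ∀ x : L, (x : Ω) ∈ H ↔ f x = 0 := fun x => by
    rw [← LinearMap.mem_ker, hker]; rfl
  have hproj : ∀ x : L, ((x - f x • v : L) : Ω) ∈ H := fun x => by
    rw [hmem]; simp [hfv]
  have hdecomp : ∀ m ∈ perpBilin B H, ∀ x : L, B x m = f x * B v m := by
    intro m hm x
    have h := hm _ (hproj x)
    rw [hsymm] at h
    simpa [sub_eq_zero] using h
  refine ⟨?_, ?_, ?_⟩
  · have hmap : (M ⊓ perpBilin B H : Submodule k Ω) =
        ((H.comap L.subtype).dualAnnihilator.comap e.toLinearMap).map M.subtype := by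
      ext m
      simp only [Submodule.mem_inf, Submodule.mem_map, Submodule.mem_comap,
        Submodule.mem_dualAnnihilator]
      constructor
      · rintro ⟨hm, hmH⟩
        exact ⟨⟨m, hm⟩, fun x hx => hmH x hx, rfl⟩
      · rintro ⟨m, hm, rfl⟩
        exact ⟨m.2, fun u hu => hm ⟨u, hHL hu⟩ hu⟩
    have hann := Subspace.finrank_add_finrank_dualAnnihilator_eq (H.comap L.subtype)
    rw [hmap, Submodule.finrank_map_subtype_eq, Submodule.comap_equiv_eq_map_symm,
      LinearEquiv.finrank_map_eq]
    omega
  · rintro ⟨ψ, hψM, hψa, hψH⟩ ⟨χ, hχM, hχa, hχH⟩ h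
    have hH0 : ∀ x : L, (x : Ω) ∈ H → ψ x = χ x := fun x hx =>
      congrArg Subtype.val (LinearMap.congr_fun h ⟨x, hx⟩)
    have hv : ψ v = χ v := by
      have hself : ∀ ψ : L →ₗ[k] Ω, (∀ x y : L, B x (ψ y) = - B y (ψ x)) → B v (ψ v) = 0 := by
        intro ψ hψ
        have h2 : (2 : k) * B v (ψ v) = 0 := by linear_combination hψ v v
        exact (mul_eq_zero.1 h2).resolve_left hchar
      refine congrArg Subtype.val (e.injective
        (LinearMap.ext fun x => ?_) : (⟨ψ v, hψM v⟩ : M) = ⟨χ v, hχM v⟩)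
      rw [he, he]
      have hx : (x : Ω) = ((x - f x • v : L) : Ω) + f x • (v : Ω) := by simp
      rw [hx]
      simp only [map_add, LinearMap.add_apply, map_smul, LinearMap.smul_apply]
      rw [hself ψ hψa, hself χ hχa, hψa, hχa, hH0 _ (hproj x)]
    refine Subtype.ext (LinearMap.ext fun x => ?_)
    have hx : x = (x - f x • v) + f x • v := by simp
    change ψ x = χ x
    rw [hx, map_add, map_add, map_smul, map_smul, hv, hH0 _ (hproj x)]
  · intro φ
    let p : L →ₗ[k] H := LinearMap.codRestrict H
      (L.subtype ∘ₗ (LinearMap.id - f.smulRight v)) hproj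
    let g : L →ₗ[k] Ω := (M ⊓ perpBilin B H).subtype ∘ₗ φ ∘ₗ p
    have hg : ∀ x, g x ∈ M ⊓ perpBilin B H := fun x => (φ (p x)).2
    let w : M := e.symm (B v ∘ₗ g)
    have hw : ∀ x : L, B x w = B v (g x) := fun x => by
      rw [← he, e.apply_symm_apply]; rfl
    let ψ : L →ₗ[k] Ω := g - f.smulRight (w : Ω)
    have hψ : ∀ x, ψ x = g x - f x • (w : Ω) := fun _ => rfl
    have hψH : ∀ x : H, ψ (Submodule.inclusion hHL x) = φ x := by
      intro x
      have hfx : f (Submodule.inclusion hHL x) = 0 := (hmem _).1 x.2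
      have hpx : p (Submodule.inclusion hHL x) = x := by
        refine Subtype.ext ?_
        change ((Submodule.inclusion hHL x - f (Submodule.inclusion hHL x) • v : L) : Ω) = x
        rw [hfx, zero_smul, sub_zero, Submodule.coe_inclusion]
      rw [hψ, hfx, zero_smul, sub_zero]
      simp [g, hpx]
    refine ⟨⟨ψ, fun x => M.sub_mem (hg x).1 (M.smul_mem _ w.2), fun x y => ?_,
      fun x => hψH x ▸ (φ x).2⟩, LinearMap.ext fun x => Subtype.ext (hψH x)⟩
    rw [hψ, hψ, map_sub, map_sub, map_smul, map_smul, hw, hw,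
      hdecomp _ (hg y).2 x, hdecomp _ (hg x).2 y, smul_eq_mul, smul_eq_mul]
    ring
end

section
/- Let k be a field, c ≥ 2 an integer, and h₁,…,h_{c−1} ∈ k with h_{c−1} ≠ 0. In the polynomial ring k[X₁,…,X_{c−1},A], let I be the ideal generated by A − (h₁X₁ + ⋯ + h_{c−1}X_{c−1}), A·X₁, and the elements X_{i−1} + A·X_i for 2 ≤ i ≤ c−1. Then the localization of the quotient ring k[X₁,…,X_{c−1},A]/I at the maximal ideal generated by the images of X₁,…,X_{c−1},A is isomorphic as a k-algebra to k[X]/(X^c). -/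
open Polynomial in
/-- A polynomial with unit constant coefficient takes a unit value at a nilpotent element. -/
theorem isUnit_aeval_of_isNilpotent {k S : Type*} [CommRing k] [CommRing S] [Algebra k S]
    {a : S} (ha : IsNilpotent a) {p : k[X]} (hp : IsUnit (p.coeff 0)) :
    IsUnit (aeval a p) := by
  rw [← p.divX_mul_X_add, map_add, map_mul, aeval_X, aeval_C]
  exact ((Commute.all _ _).isNilpotent_mul_left ha).isUnit_add_right_of_commute
    (hp.map (algebraMap k S)) (Commute.all _ _)

open Polynomial in
/-- The polynomial `∑ i, hᵢ (-X) ^ (n - i)`. -/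
noncomputable def reversedAltSum {k : Type*} [CommRing k] {n : ℕ} (h : Fin (n + 1) → k) : k[X] :=
  ∑ i, C (h i) * (-X) ^ (n - i.val)

open Polynomial in
theorem aeval_reversedAltSum {k S : Type*} [CommRing k] [CommRing S] [Algebra k S] {n : ℕ}
    (h : Fin (n + 1) → k) (a : S) :
    aeval a (reversedAltSum h) = ∑ i, algebraMap k S (h i) * (-a) ^ (n - i.val) := by
  simp [reversedAltSum]

theorem coeff_zero_reversedAltSum {k : Type*} [CommRing k] {n : ℕ} (h : Fin (n + 1) → k) :
    (reversedAltSum h).coeff 0 = h (Fin.last n) := by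
  rw [Polynomial.coeff_zero_eq_aeval_zero, aeval_reversedAltSum,
    Finset.sum_eq_single (Fin.last n)]
  · simp
  · intro i _ hi
    have : n - i.val ≠ 0 := by
      have := Fin.val_lt_last hi
      omega
    simp [this]
  · simp

theorem eq_neg_pow_mul_last {S : Type*} [CommRing S] {n : ℕ} {a : S} {x : Fin (n + 1) → S}
    (hx : ∀ i : Fin n, x i.castSucc + a * x i.succ = 0) (i : Fin (n + 1)) :
    x i = (-a) ^ (n - i.val) * x (Fin.last n) := by
  induction i using Fin.reverseInduction with
  | last => simp
  | cast i ih =>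
    have e : n - i.castSucc.val = (n - i.succ.val) + 1 := by
      simp only [Fin.val_castSucc, Fin.val_succ]
      omega
    rw [eq_neg_of_add_eq_zero_left (hx i), ih, e]
    ring

section Relations

variable {k S : Type*} [CommRing k] [CommRing S] [Algebra k S] {n : ℕ} {h : Fin (n + 1) → k}
  {a : S} {x : Fin (n + 1) → S}

theorem eq_aeval_reversedAltSum_mul_last (hx : ∀ i : Fin n, x i.castSucc + a * x i.succ = 0)
    (ha : a = ∑ i, algebraMap k S (h i) * x i) :
    a = Polynomial.aeval a (reversedAltSum h) * x (Fin.last n) := by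
  rw [aeval_reversedAltSum, Finset.sum_mul]
  conv_lhs => rw [ha]
  refine Finset.sum_congr rfl fun i _ => ?_
  rw [eq_neg_pow_mul_last hx i, mul_assoc]

theorem pow_add_two_eq_zero_of_relations (hx : ∀ i : Fin n, x i.castSucc + a * x i.succ = 0)
    (ha : a = ∑ i, algebraMap k S (h i) * x i) (h0 : a * x 0 = 0) : a ^ (n + 2) = 0 := by
  have h1 : a * (a ^ n * x (Fin.last n)) = 0 := by
    rw [eq_neg_pow_mul_last hx 0, neg_pow] at h0
    have := congrArg (fun z => (-1) ^ n * z) h0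
    simp only [Fin.val_zero, Nat.sub_zero, mul_zero] at this
    rw [← this]
    have e : ((-1 : S) ^ n) * (-1) ^ n = 1 := by rw [← mul_pow]; simp
    linear_combination (-(a * (a ^ n * x (Fin.last n)))) * e
  have h2 := eq_aeval_reversedAltSum_mul_last hx ha
  calc a ^ (n + 2) = a * a ^ n * a := by ring
    _ = a * a ^ n * (Polynomial.aeval a (reversedAltSum h) * x (Fin.last n)) := by rw [← h2]
    _ = a * (a ^ n * x (Fin.last n)) * Polynomial.aeval a (reversedAltSum h) := by ring
    _ = 0 := by rw [h1, zero_mul]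

end Relations

/-- If an ideal is generated by the nilpotent images of the variables in a nontrivial quotient of a
polynomial ring over a field, then every element outside it is a unit. -/
theorem isUnit_of_notMem_span_range_mk_X {k σ : Type*} [Field k] {I : Ideal (MvPolynomial σ k)}
    (hnil : ∀ s, IsNilpotent (Ideal.Quotient.mk I (MvPolynomial.X s)))
    {q : MvPolynomial σ k ⧸ I}
    (hq : q ∉ Ideal.span (Set.range fun s => Ideal.Quotient.mk I (MvPolynomial.X s))) :
    IsUnit q := by
  set 𝔪 := Ideal.span (Set.range fun s => Ideal.Quotient.mk I (MvPolynomial.X s)) with h𝔪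
  have hle : 𝔪 ≤ nilradical (MvPolynomial σ k ⧸ I) := by
    rw [h𝔪, Ideal.span_le]
    rintro _ ⟨s, rfl⟩
    exact hnil s
  have hdec : ∀ q : MvPolynomial σ k ⧸ I, ∃ b : k, q - algebraMap k _ b ∈ 𝔪 := by
    intro q
    obtain ⟨p, rfl⟩ := Ideal.Quotient.mk_surjective q
    induction p using MvPolynomial.induction_on with
    | C b => exact ⟨b, by
        rw [show Ideal.Quotient.mk I (MvPolynomial.C b) = algebraMap k _ b from rfl, sub_self]
        exact 𝔪.zero_mem⟩
    | add p q hp hq =>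
      obtain ⟨b, hb⟩ := hp
      obtain ⟨d, hd⟩ := hq
      refine ⟨b + d, ?_⟩
      rw [map_add, map_add, add_sub_add_comm]
      exact 𝔪.add_mem hb hd
    | mul_X p s _ =>
      refine ⟨0, ?_⟩
      rw [map_zero, sub_zero, map_mul]
      exact 𝔪.mul_mem_left _ (Ideal.subset_span ⟨s, rfl⟩)
  obtain ⟨b, hb⟩ := hdec q
  have hb0 : b ≠ 0 := by
    rintro rfl
    rw [map_zero, sub_zero] at hb
    exact hq hb
  have := (show IsNilpotent _ from hle hb).isUnit_add_right_of_commute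
    ((isUnit_iff_ne_zero.2 hb0).map (algebraMap k (MvPolynomial σ k ⧸ I))) (Commute.all _ _)
  rwa [sub_add_cancel] at this

theorem Ideal.isMaximal_of_forall_notMem_isUnit {S : Type*} [CommRing S] {J : Ideal S}
    (hJ : J ≠ ⊤) (hu : ∀ q ∉ J, IsUnit q) : J.IsMaximal := by
  refine ⟨hJ, fun K hK => ?_⟩
  obtain ⟨q, hqK, hqJ⟩ := Set.exists_of_ssubset hK
  exact K.eq_top_of_isUnit_mem hqK (hu q hqJ)

/-- Let `k` be a field, `c ≥ 2`, and `h₁, …, h_{c−1} ∈ k` with `h_{c−1} ≠ 0`.  In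
`k[X₁, …, X_{c−1}, A]` (formalized as `MvPolynomial (Fin (c-1) ⊕ Unit) k`, where
`Sum.inl i` is `X_{i+1}` and `Sum.inr ()` is `A`), let `I` be the ideal generated by
`A − (h₁X₁ + ⋯ + h_{c−1}X_{c−1})`, `A·X₁`, and `X_{i−1} + A·X_i` for `2 ≤ i ≤ c−1`.
Then the localization of `k[X₁,…,X_{c−1},A]/I` at the maximal ideal `𝔪` generated by the
images of the variables is `k`-algebra isomorphic to `k[X]/(X^c)`.  (We assert that `𝔪`
is maximal, and that for the resulting prime ideal the localization is as claimed.) -/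
theorem stmt_7 {k : Type*} [Field k] (c : ℕ) (hc : 2 ≤ c) (h : Fin (c - 1) → k)
    (hlast : h ⟨c - 2, by omega⟩ ≠ 0)
    (I : Ideal (MvPolynomial (Fin (c - 1) ⊕ Unit) k))
    (hI : I = Ideal.span
      ({MvPolynomial.X (Sum.inr ()) -
          ∑ i : Fin (c - 1), MvPolynomial.C (h i) * MvPolynomial.X (Sum.inl i),
        MvPolynomial.X (Sum.inr ()) * MvPolynomial.X (Sum.inl ⟨0, by omega⟩)} ∪
        {q | ∃ j : Fin (c - 1), 1 ≤ j.val ∧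
          q = MvPolynomial.X
                (Sum.inl ⟨j.val - 1, lt_of_le_of_lt (Nat.sub_le _ _) j.isLt⟩) +
              MvPolynomial.X (Sum.inr ()) * MvPolynomial.X (Sum.inl j)}))
    (𝔪 : Ideal (MvPolynomial (Fin (c - 1) ⊕ Unit) k ⧸ I))
    (h𝔪 : 𝔪 = Ideal.span (Set.range fun s => Ideal.Quotient.mk I (MvPolynomial.X s))) :
    𝔪.IsMaximal ∧
      ∀ hm : 𝔪.IsPrime,
        Nonempty ((Localization (@Ideal.primeCompl _ _ 𝔪 hm)) ≃ₐ[k]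
          (Polynomial k ⧸ Ideal.span {(Polynomial.X : Polynomial k) ^ c})) := by
  obtain ⟨n, rfl⟩ : ∃ n, c = n + 2 := ⟨c - 2, by omega⟩
  change Fin (n + 1) → k at h
  change h (Fin.last n) ≠ 0 at hlast
  let Q := MvPolynomial (Fin (n + 1) ⊕ Unit) k ⧸ I
  let R := Polynomial k ⧸ Ideal.span {(Polynomial.X : Polynomial k) ^ (n + 2)}
  let a : Q := Ideal.Quotient.mk I (MvPolynomial.X (Sum.inr ()))
  let x : Fin (n + 1) → Q := fun i => Ideal.Quotient.mk I (MvPolynomial.X (Sum.inl i))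
  let u := reversedAltSum h
  have hu0 : IsUnit (u.coeff 0) := by
    rw [coeff_zero_reversedAltSum]
    exact isUnit_iff_ne_zero.2 hlast
  have ha : a = ∑ i, algebraMap k Q (h i) * x i := by
    have : Ideal.Quotient.mk I (MvPolynomial.X (Sum.inr ()) -
        ∑ i : Fin (n + 1), MvPolynomial.C (h i) * MvPolynomial.X (Sum.inl i)) = 0 := by
      rw [Ideal.Quotient.eq_zero_iff_mem, hI]
      exact Ideal.subset_span (Or.inl (Or.inl rfl))
    rw [map_sub, map_sum, sub_eq_zero] at this
    simp only [map_mul] at this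
    exact this
  have hx0 : a * x 0 = 0 := by
    rw [← map_mul, Ideal.Quotient.eq_zero_iff_mem, hI]
    exact Ideal.subset_span (Or.inl (Or.inr rfl))
  have hx : ∀ i : Fin n, x i.castSucc + a * x i.succ = 0 := by
    intro i
    rw [← map_mul, ← map_add, Ideal.Quotient.eq_zero_iff_mem, hI]
    exact Ideal.subset_span (Or.inr ⟨i.succ, by simp, rfl⟩)
  have hapow : a ^ (n + 2) = 0 := pow_add_two_eq_zero_of_relations hx ha hx0
  have hau : a = Polynomial.aeval a u * x (Fin.last n) := eq_aeval_reversedAltSum_mul_last hx ha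
  let t : R := Ideal.Quotient.mk _ Polynomial.X
  have htpow : t ^ (n + 2) = 0 := by
    rw [← map_pow, Ideal.Quotient.eq_zero_iff_mem]
    exact Ideal.mem_span_singleton_self _
  obtain ⟨v, hv⟩ := (isUnit_aeval_of_isNilpotent ⟨_, htpow⟩ hu0).exists_right_inv
  let F : MvPolynomial (Fin (n + 1) ⊕ Unit) k →ₐ[k] R :=
    MvPolynomial.aeval (Sum.elim (fun i => (-t) ^ (n - i.val) * (t * v)) fun _ => t)
  have hFA : F (MvPolynomial.X (Sum.inr ())) = t := by simp [F]
  have hFX : ∀ i, F (MvPolynomial.X (Sum.inl i)) = (-t) ^ (n - i.val) * (t * v) := by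
    intro i
    simp [F]
  have hF : ∀ p ∈ I, F p = 0 := by
    suffices I ≤ RingHom.ker F from fun p hp => this hp
    rw [hI, Ideal.span_le]
    rintro p ((rfl | rfl) | ⟨j, hj, rfl⟩)
    · change F (_ - ∑ i : Fin (n + 1), _) = 0
      have e : t = ∑ i : Fin (n + 1),
          algebraMap k R (h i) * ((-t) ^ (n - i.val) * (t * v)) := by
        simp only [← mul_assoc]
        rw [← Finset.sum_mul, ← Finset.sum_mul, ← aeval_reversedAltSum]
        linear_combination (-t) * hv
      rw [map_sub, map_sum, hFA, sub_eq_zero]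
      refine e.trans (Finset.sum_congr rfl fun i _ => ?_)
      rw [map_mul, hFX]
      exact congrArg (· * _) (F.commutes (h i)).symm
    · change F _ = 0
      rw [map_mul, hFA]
      refine (congrArg (t * ·) (hFX 0)).trans ?_
      simp only [Fin.val_zero, Nat.sub_zero]
      linear_combination ((-1) ^ n * v) * htpow + t * t * v * neg_pow t n
    · change F _ = 0
      rw [map_add, map_mul, hFA]
      refine (congrArg₂ (· + t * ·) (hFX _) (hFX j)).trans ?_
      have hj' : j.val < n + 1 := j.isLt
      have e : n - (j.val - 1) = (n - j.val) + 1 := by omega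
      simp only [e]
      ring
  let f : Q →ₐ[k] R := Ideal.Quotient.liftₐ I F hF
  let g : R →ₐ[k] Q := Ideal.Quotient.liftₐ _ (Polynomial.aeval a) (by
    suffices Ideal.span {Polynomial.X ^ (n + 2)} ≤ RingHom.ker (Polynomial.aeval (R := k) a) from
      fun p hp => this hp
    rw [Ideal.span_singleton_le_iff_mem, RingHom.mem_ker, map_pow, Polynomial.aeval_X, hapow])
  have hgt : g t = a := Polynomial.aeval_X (R := k) a
  have hfa : f a = t := hFA
  have hgv : a * g v = x (Fin.last n) := by
    have e : Polynomial.aeval a u * g v = 1 := by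
      rw [← hgt, Polynomial.aeval_algHom_apply, ← map_mul, hv, map_one]
    linear_combination g v * hau + x (Fin.last n) * e
  have hfg : f.comp g = AlgHom.id k R := by
    apply Ideal.Quotient.algHom_ext
    apply Polynomial.algHom_ext
    change f (g t) = t
    rw [hgt, hfa]
  have hgf : g.comp f = AlgHom.id k Q := by
    apply Ideal.Quotient.algHom_ext
    apply MvPolynomial.algHom_ext
    rintro (i | ⟨⟩)
    · change g (F (MvPolynomial.X (Sum.inl i))) = x i
      rw [hFX, map_mul, map_mul, map_pow, map_neg, hgt, hgv, ← eq_neg_pow_mul_last hx]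
    · change g (f a) = a
      rw [hfa, hgt]
  let e : Q ≃ₐ[k] R := AlgEquiv.ofAlgHom f g hfg hgf
  have hnil : ∀ s, IsNilpotent (Ideal.Quotient.mk I (MvPolynomial.X s)) := by
    have han : IsNilpotent a := ⟨_, hapow⟩
    rintro (i | ⟨⟩)
    · change IsNilpotent (x i)
      rw [eq_neg_pow_mul_last hx, ← hgv]
      exact (Commute.all _ _).isNilpotent_mul_left ((Commute.all _ _).isNilpotent_mul_right han)
    · exact han
  have hunit : ∀ q ∉ 𝔪, IsUnit q := by
    rw [h𝔪]
    exact fun q hq => isUnit_of_notMem_span_range_mk_X hnil hq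
  have hR : Nontrivial R := by
    refine Ideal.Quotient.nontrivial_iff.2 fun htop => ?_
    rw [Ideal.span_singleton_eq_top, isUnit_pow_iff (by omega)] at htop
    exact Polynomial.not_isUnit_X htop
  have hQ : Nontrivial Q := e.toEquiv.nontrivial
  have htop : 𝔪 ≠ ⊤ := by
    intro htop
    have hle : 𝔪 ≤ nilradical Q := by
      rw [h𝔪, Ideal.span_le]
      rintro _ ⟨s, rfl⟩
      exact hnil s
    exact not_isNilpotent_one (hle (htop ▸ Submodule.mem_top : (1 : Q) ∈ 𝔪))
  refine ⟨Ideal.isMaximal_of_forall_notMem_isUnit htop hunit, fun hm => ⟨?_⟩⟩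
  let E := IsLocalization.atUnits Q 𝔪.primeCompl (S := Localization 𝔪.primeCompl) hunit
  exact (E.restrictScalars k).symm.trans e
end

section
/- Let k be a field of characteristic p > 0 and let c be a positive integer with c < p. Let n be a positive integer, I a proper ideal of the formal power series ring k[[X₁,…,X_n]], and set R := k[[X₁,…,X_n]]/I, a local ring with maximal ideal 𝔪. If there is a k-algebra isomorphism R/𝔪^p ≅ k[X]/(X^c), then there is a k-algebra isomorphism R ≅ k[X]/(X^c). -/
theorem Ideal.pow_eq_bot_of_pow_le_pow {R : Type*} [CommRing R] [IsLocalRing R]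
    [IsNoetherianRing R] {J : Ideal R} (hJ : J ≠ ⊤) {c p : ℕ} (hcp : c < p)
    (h : J ^ c ≤ J ^ p) : J ^ p = ⊥ := by
  have hc : J ^ c = ⊥ := by
    refine Submodule.eq_bot_of_le_smul_of_le_jacobson_bot J _ (IsNoetherian.noetherian _) ?_
      ((IsLocalRing.le_maximalIdeal hJ).trans (IsLocalRing.maximalIdeal_le_jacobson _))
    rw [smul_eq_mul, ← pow_succ']
    exact h.trans (Ideal.pow_le_pow_right hcp)
  exact le_bot_iff.mp (hc ▸ Ideal.pow_le_pow_right hcp.le)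

theorem Polynomial.mem_span_mk_X_of_isNilpotent {k : Type*} [Field k] {c : ℕ} (hc : 0 < c)
    {a : Polynomial k ⧸ Ideal.span {(Polynomial.X : Polynomial k) ^ c}} (ha : IsNilpotent a) :
    a ∈ Ideal.span {Ideal.Quotient.mk (Ideal.span {(Polynomial.X : Polynomial k) ^ c})
      Polynomial.X} := by
  obtain ⟨f, rfl⟩ := Ideal.Quotient.mk_surjective a
  obtain ⟨m, hm⟩ := ha
  rw [← map_pow, Ideal.Quotient.eq_zero_iff_mem, Ideal.mem_span_singleton] at hm
  exact Ideal.mem_span_singleton.mpr <| _root_.map_dvd _ <|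
    Polynomial.prime_X.dvd_of_dvd_pow ((dvd_pow_self _ hc.ne').trans hm)

theorem Ideal.pow_le_pow_of_quotient_algEquiv {k R : Type*} [Field k] [CommRing R] [Algebra k R]
    {J : Ideal R} {c p : ℕ} (hc : 0 < c)
    (e : (R ⧸ J ^ p) ≃ₐ[k] (Polynomial k ⧸ Ideal.span {(Polynomial.X : Polynomial k) ^ c})) :
    J ^ c ≤ J ^ p := by
  let φ := e.toRingEquiv.toRingHom.comp (Ideal.Quotient.mk (J ^ p))
  have hφ (r : R) : φ r = 0 ↔ r ∈ J ^ p := by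
    simp [φ, Ideal.Quotient.eq_zero_iff_mem]
  have hmap : J.map φ ≤ Ideal.span {Ideal.Quotient.mk _ Polynomial.X} := by
    refine Ideal.map_le_iff_le_comap.mpr fun r hr => ?_
    refine Polynomial.mem_span_mk_X_of_isNilpotent hc ⟨p, ?_⟩
    rw [← map_pow, hφ]
    exact Ideal.pow_mem_pow hr p
  have hbot : (J ^ c).map φ ≤ ⊥ := by
    rw [Ideal.map_pow]
    refine (Ideal.pow_right_mono hmap c).trans ?_
    rw [Ideal.span_singleton_pow, ← map_pow, Ideal.Quotient.eq_zero_iff_mem.mpr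
      (Ideal.mem_span_singleton_self _), Ideal.span_singleton_zero]
  exact fun r hr => (hφ r).mp (Ideal.mem_bot.mp (hbot (Ideal.mem_map_of_mem φ hr)))


set_option synthInstance.maxHeartbeats 1000000 in
/-- Let `k` be a field of characteristic `p > 0` and `c` a positive integer with `c < p`.
Let `n` be a positive integer, `I` a proper ideal of `k[[X₁,…,X_n]]`, and
`R := k[[X₁,…,X_n]]/I`, a local ring with maximal ideal `𝔪` (we quantify over all
maximal ideals `𝔪` of `R`; the ring `R` is local, so this is the unique one).
If `R/𝔪^p ≅ k[X]/(X^c)` as `k`-algebras, then `R ≅ k[X]/(X^c)` as `k`-algebras. -/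
theorem stmt_8 {k : Type*} [Field k] (p : ℕ) [CharP k p] (hp : 0 < p)
    (c : ℕ) (hc : 0 < c) (hcp : c < p) (n : ℕ) (hn : 0 < n)
    (I : Ideal (MvPowerSeries (Fin n) k)) (hI : I ≠ ⊤)
    (𝔪 : Ideal (MvPowerSeries (Fin n) k ⧸ I)) (h𝔪 : 𝔪.IsMaximal)
    (h : Nonempty (((MvPowerSeries (Fin n) k ⧸ I) ⧸ 𝔪 ^ p) ≃ₐ[k]
      (Polynomial k ⧸ Ideal.span {(Polynomial.X : Polynomial k) ^ c}))) :
    Nonempty ((MvPowerSeries (Fin n) k ⧸ I) ≃ₐ[k]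
      (Polynomial k ⧸ Ideal.span {(Polynomial.X : Polynomial k) ^ c})) := by
  obtain ⟨e⟩ := h
  have : Nontrivial (MvPowerSeries (Fin n) k ⧸ I) := Ideal.Quotient.nontrivial_iff.mpr hI
  have : IsLocalRing (MvPowerSeries (Fin n) k ⧸ I) :=
    .of_surjective' _ Ideal.Quotient.mk_surjective
  have hbot : 𝔪 ^ p = ⊥ :=
    Ideal.pow_eq_bot_of_pow_le_pow h𝔪.ne_top hcp (Ideal.pow_le_pow_of_quotient_algEquiv hc e)
  exact ⟨(AlgEquiv.quotientBot k _).symm.trans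
    ((Ideal.quotientEquivAlgOfEq k hbot.symm).trans e)⟩
end

section
/- Let k be a field, V a finite-dimensional k-vector space with a nondegenerate symmetric bilinear form B, and g a linear automorphism of V with B(gx, gy) = B(x, y) for all x, y ∈ V. Let U ⊆ V be a g-invariant totally isotropic subspace. Then U^⊥ := {v ∈ V : B(v, u) = 0 for all u ∈ U} is g-invariant, and the characteristic polynomial of the endomorphism of V/U^⊥ induced by g equals the normalized reciprocal of the characteristic polynomial of g restricted to U. -/
open Polynomial in
/-- The characteristic polynomial of an inverse is the normalized reciprocal. -/
theorem LinearEquiv.charpoly_symm_eq_reverse {k M : Type*} [Field k] [AddCommGroup M]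
    [Module k M] [FiniteDimensional k M] (e : M ≃ₗ[k] M) :
    (e.symm : M →ₗ[k] M).charpoly =
      C (((e : M →ₗ[k] M).charpoly.coeff 0)⁻¹) * (e : M →ₗ[k] M).charpoly.reverse := by
  classical
  let b := Module.finBasis k M
  set A := LinearMap.toMatrix b b (e : M →ₗ[k] M) with hA
  have hmul : LinearMap.toMatrix b b (e.symm : M →ₗ[k] M) * A = 1 := by
    rw [hA, ← LinearMap.toMatrix_comp]
    simp
  have hinv : LinearMap.toMatrix b b (e.symm : M →ₗ[k] M) = A⁻¹ :=
    (Matrix.inv_eq_left_inv hmul).symm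
  have hunit : IsUnit A := IsUnit.of_mul_eq_one_right _ hmul
  rw [← LinearMap.charpoly_toMatrix _ b, ← LinearMap.charpoly_toMatrix (e : M →ₗ[k] M) b, hinv,
    ← hA, Matrix.charpoly_inv A hunit, Matrix.reverse_charpoly, Matrix.det_eq_sign_charpoly_coeff,
    Ring.inverse_eq_inv', mul_inv, C_mul, ← mul_assoc]
  have hsign : (-1 : k[X]) ^ Fintype.card (Fin (Module.finrank k M)) *
      C (((-1 : k) ^ Fintype.card (Fin (Module.finrank k M)))⁻¹) = 1 := by
    rw [← inv_pow, inv_neg_one, C_pow, C_neg, C_1, ← mul_pow]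
    simp
  rw [hsign, one_mul]

/-- An endomorphism and its dual map have the same characteristic polynomial. -/
theorem LinearMap.charpoly_dualMap_eq {k M : Type*} [Field k] [AddCommGroup M]
    [Module k M] [FiniteDimensional k M] (f : M →ₗ[k] M) :
    f.dualMap.charpoly = f.charpoly := by
  classical
  let b := Module.finBasis k M
  rw [← LinearMap.charpoly_toMatrix f b, ← LinearMap.charpoly_toMatrix f.dualMap b.dualBasis,
    ← Matrix.charpoly_transpose (LinearMap.toMatrix b b f), ← LinearMap.toMatrix_transpose]
  rfl

/-- A nondegenerate form identifies `V / U^⊥` with the dual of `U`. -/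
theorem exists_quotient_perpBilin_equiv_dual {k V : Type*} [Field k] [AddCommGroup V] [Module k V]
    [FiniteDimensional k V] (B : LinearMap.BilinForm k V) (hnondeg : B.Nondegenerate)
    (U : Submodule k V) :
    ∃ φ : (V ⧸ perpBilin B U) ≃ₗ[k] Module.Dual k U,
      ∀ (v : V) (u : U), φ (Submodule.Quotient.mk v) u = B v u := by
  let ψ : V →ₗ[k] Module.Dual k U := U.dualRestrict ∘ₗ B
  have hker : perpBilin B U = LinearMap.ker ψ := by
    ext v
    refine ⟨fun h => LinearMap.ext fun u => h u u.2, fun h u hu => ?_⟩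
    exact LinearMap.congr_fun (LinearMap.mem_ker.mp h) ⟨u, hu⟩
  have hsurj : Function.Surjective ψ :=
    Subspace.dualRestrict_surjective.comp (LinearMap.BilinForm.toDual B hnondeg).surjective
  exact ⟨(Submodule.quotEquivOfEq _ _ hker).trans (ψ.quotKerEquivOfSurjective hsurj),
    fun _ _ => rfl⟩

/-- Let `k` be a field, `V` a finite-dimensional `k`-vector space with a nondegenerate
symmetric bilinear form `B`, and `g` a linear automorphism of `V` preserving `B`.  Let
`U ⊆ V` be a `g`-invariant totally isotropic subspace.  Then `U^⊥` is `g`-invariant, and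
the characteristic polynomial of the endomorphism of `V/U^⊥` induced by `g` equals the
normalized reciprocal `P(0)⁻¹ · Tᵐ · P(1/T)` (i.e. `C (P.coeff 0)⁻¹ * P.reverse`) of the
characteristic polynomial `P` of `g` restricted to `U`. -/
theorem stmt_9 {k V : Type*} [Field k] [AddCommGroup V] [Module k V]
    [FiniteDimensional k V]
    (B : LinearMap.BilinForm k V) (hsymm : ∀ x y : V, B x y = B y x)
    (hnondeg : B.Nondegenerate)
    (g : V ≃ₗ[k] V) (hg : ∀ x y : V, B (g x) (g y) = B x y)
    (U : Submodule k V) (hU : ∀ u ∈ U, g u ∈ U)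
    (hUiso : ∀ x ∈ U, ∀ y ∈ U, B x y = 0) :
    (∀ v ∈ perpBilin B U, g v ∈ perpBilin B U) ∧
      ∀ hperp : perpBilin B U ≤ (perpBilin B U).comap (g : V →ₗ[k] V),
        (Submodule.mapQ (perpBilin B U) (perpBilin B U) (g : V →ₗ[k] V) hperp).charpoly =
          Polynomial.C ((((g : V →ₗ[k] V).restrict hU).charpoly.coeff 0)⁻¹) *
            (((g : V →ₗ[k] V).restrict hU).charpoly).reverse := by
  let e : U ≃ₗ[k] U := LinearEquiv.ofInjectiveEndo ((g : V →ₗ[k] V).restrict hU)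
    fun x y h => Subtype.ext (g.injective (congrArg Subtype.val h))
  have hadj (v : V) (u : U) : B (g v) u = B v (e.symm u) := by
    rw [← hg v]
    exact congrArg (fun w : U => B (g v) w) (e.apply_symm_apply u).symm
  refine ⟨fun v hv u hu => (hadj v ⟨u, hu⟩).trans (hv _ (e.symm ⟨u, hu⟩).2), fun hperp => ?_⟩
  obtain ⟨φ, hφ⟩ := exists_quotient_perpBilin_equiv_dual B hnondeg U
  have hconj : φ.conj ((perpBilin B U).mapQ (perpBilin B U) (g : V →ₗ[k] V) hperp) =
      (e.symm : U →ₗ[k] U).dualMap := by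
    ext f u
    obtain ⟨q, rfl⟩ := φ.surjective f
    obtain ⟨v, rfl⟩ := Submodule.Quotient.mk_surjective _ q
    rw [LinearEquiv.conj_apply_apply, LinearEquiv.symm_apply_apply, Submodule.mapQ_apply, hφ]
    exact (hadj v u).trans (hφ v _).symm
  rw [← LinearEquiv.charpoly_conj φ, hconj, LinearMap.charpoly_dualMap_eq]
  exact e.charpoly_symm_eq_reverse
end

section
/- Let k be a field, V a finite-dimensional k-vector space with a nondegenerate symmetric bilinear form B, and g a linear automorphism of V with B(gx, gy) = B(x, y) for all x, y ∈ V. Let M ⊆ V be a g-invariant Lagrangian subspace, i.e. M = M^⊥. Then the characteristic polynomial of g on V equals the characteristic polynomial of g restricted to M multiplied by the normalized reciprocal of the characteristic polynomial of g restricted to M. -/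
/-- The characteristic polynomial is multiplicative along an invariant subspace. -/
theorem charpoly_eq_charpoly_restrict_mul_charpoly_mapQ {k V : Type*} [Field k]
    [AddCommGroup V] [Module k V] [FiniteDimensional k V] (f : V →ₗ[k] V)
    (W : Submodule k V) (hW : ∀ u ∈ W, f u ∈ W) :
    f.charpoly = (f.restrict hW).charpoly * (W.mapQ W f hW).charpoly := by
  classical
  let bW := Module.Free.chooseBasis k W
  let bQ := Module.Free.chooseBasis k (V ⧸ W)
  let b := Module.Basis.sumQuot bW bQ
  suffices LinearMap.toMatrix b b f = Matrix.fromBlocks (LinearMap.toMatrix bW bW (f.restrict hW))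
      (Matrix.of fun i l ↦ b.repr (f (b (Sum.inr l))) (Sum.inl i)) 0
      (LinearMap.toMatrix bQ bQ (W.mapQ W f hW)) by
    rw [← LinearMap.charpoly_toMatrix f b, this, ← LinearMap.charpoly_toMatrix _ bW,
      ← LinearMap.charpoly_toMatrix _ bQ, Matrix.charpoly_fromBlocks_zero₂₁]
  ext u v
  rcases u with i | j <;> rcases v with l | l
  · simp only [b, Module.Basis.sumQuot_inl, Matrix.fromBlocks_apply₁₁, LinearMap.toMatrix_apply]
    apply Module.Basis.sumQuot_repr_inl_of_mem
  · simp [LinearMap.toMatrix_apply, Matrix.fromBlocks_apply₁₂]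
  · suffices W.mkQ (f (bW l)) = 0 by simp [LinearMap.toMatrix_apply, b, this]
    rw [← LinearMap.mem_ker, Submodule.ker_mkQ]
    exact hW _ (Submodule.coe_mem (bW l))
  · simp only [LinearMap.toMatrix_apply, Module.Basis.sumQuot_repr_inr,
      Matrix.fromBlocks_apply₂₂, b]
    rw [← Module.Basis.sumQuot_inr bW bQ l, W.mapQ_apply]
    simp

theorem charpoly_dualMap {k V : Type*} [Field k] [AddCommGroup V] [Module k V]
    [FiniteDimensional k V] (f : V →ₗ[k] V) : f.dualMap.charpoly = f.charpoly := by
  classical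
  let b := Module.Free.chooseBasis k V
  rw [← LinearMap.charpoly_toMatrix f b, ← LinearMap.charpoly_toMatrix f.dualMap b.dualBasis,
    LinearMap.dualMap_def, LinearMap.toMatrix_transpose, Matrix.charpoly_transpose]

/-- The characteristic polynomial of the inverse is the normalized reciprocal of the
characteristic polynomial. -/
theorem charpoly_symm {k V : Type*} [Field k] [AddCommGroup V] [Module k V]
    [FiniteDimensional k V] (e : V ≃ₗ[k] V) :
    (e.symm : V →ₗ[k] V).charpoly =
      Polynomial.C (((e : V →ₗ[k] V).charpoly.coeff 0)⁻¹) * (e : V →ₗ[k] V).charpoly.reverse := by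
  classical
  let b := Module.Free.chooseBasis k V
  set A := LinearMap.toMatrix b b (e : V →ₗ[k] V) with hA
  have hmul : A * LinearMap.toMatrix b b (e.symm : V →ₗ[k] V) = 1 := by
    rw [hA, ← LinearMap.toMatrix_comp]
    simp
  have hinv : LinearMap.toMatrix b b (e.symm : V →ₗ[k] V) = A⁻¹ :=
    (Matrix.inv_eq_right_inv hmul).symm
  have hunit : IsUnit A := IsUnit.of_mul_eq_one _ hmul
  rw [← LinearMap.charpoly_toMatrix (e.symm : V →ₗ[k] V) b,
    ← LinearMap.charpoly_toMatrix (e : V →ₗ[k] V) b, ← hA, hinv, Matrix.charpoly_inv A hunit,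
    Matrix.reverse_charpoly, Ring.inverse_eq_inv', Matrix.det_eq_sign_charpoly_coeff, mul_inv,
    Polynomial.C_mul, ← mul_assoc, ← inv_pow, Polynomial.C_pow]
  simp [inv_neg, ← mul_pow]


/-- Let `k` be a field, `V` a finite-dimensional `k`-vector space with a nondegenerate
symmetric bilinear form `B`, and `g` a linear automorphism of `V` preserving `B`.  Let
`M ⊆ V` be a `g`-invariant Lagrangian subspace (`M = M^⊥`).  Then the characteristic
polynomial of `g` on `V` equals the characteristic polynomial `P` of `g` restricted to
`M` multiplied by the normalized reciprocal `C (P.coeff 0)⁻¹ * P.reverse` of `P`. -/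
theorem stmt_10 {k V : Type*} [Field k] [AddCommGroup V] [Module k V]
    [FiniteDimensional k V]
    (B : LinearMap.BilinForm k V) (hsymm : ∀ x y : V, B x y = B y x)
    (hnondeg : B.Nondegenerate)
    (g : V ≃ₗ[k] V) (hg : ∀ x y : V, B (g x) (g y) = B x y)
    (M : Submodule k V) (hM : ∀ u ∈ M, g u ∈ M)
    (hLagrangian : M = perpBilin B M) :
    (g : V →ₗ[k] V).charpoly =
      ((g : V →ₗ[k] V).restrict hM).charpoly *
        (Polynomial.C ((((g : V →ₗ[k] V).restrict hM).charpoly.coeff 0)⁻¹) *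
          (((g : V →ₗ[k] V).restrict hM).charpoly).reverse) := by
  have hmem (v : V) : v ∈ M ↔ ∀ u ∈ M, B v u = 0 := by
    conv_lhs => rw [hLagrangian]
    rfl
  let φ : V →ₗ[k] Module.Dual k M := M.dualRestrict ∘ₗ (B.toDual hnondeg : V →ₗ[k] Module.Dual k V)
  have hφ (v : V) (m : M) : φ v m = B v m := by
    simp [φ, Submodule.dualRestrict_apply, LinearMap.BilinForm.toDual_def]
  have hφ_surj : Function.Surjective φ :=
    Subspace.dualRestrict_surjective.comp (B.toDual hnondeg).surjective
  have hφ_ker : M = LinearMap.ker φ := by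
    ext v
    rw [hmem, LinearMap.mem_ker, LinearMap.ext_iff]
    simp [hφ]
  let e : (V ⧸ M) ≃ₗ[k] Module.Dual k M :=
    (Submodule.quotEquivOfEq _ _ hφ_ker).trans (φ.quotKerEquivOfSurjective hφ_surj)
  have he (v : V) : e (M.mkQ v) = φ v := rfl
  let gM : M ≃ₗ[k] M := LinearEquiv.ofInjectiveEndo ((g : V →ₗ[k] V).restrict hM)
    (fun x y h ↦ Subtype.ext (g.injective (congrArg Subtype.val h)))
  have hgM : (gM : M →ₗ[k] M) = (g : V →ₗ[k] V).restrict hM := rfl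
  have hconj : e.conj (M.mapQ M (g : V →ₗ[k] V) hM) = (gM.symm : M →ₗ[k] M).dualMap := by
    ext ψ m
    obtain ⟨q, rfl⟩ := e.surjective ψ
    obtain ⟨v, rfl⟩ := M.mkQ_surjective q
    obtain ⟨m, rfl⟩ := gM.surjective m
    have : ((gM m : M) : V) = g m := rfl
    have h : e (M.mapQ M (g : V →ₗ[k] V) hM (M.mkQ v)) = φ (g v) := rfl
    rw [LinearEquiv.conj_apply_apply, e.symm_apply_apply, h, LinearMap.dualMap_apply, he, hφ, this,
      hg]
    simp [hφ]
  rw [charpoly_eq_charpoly_restrict_mul_charpoly_mapQ _ M hM, ← hgM, ← charpoly_symm,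
    ← charpoly_dualMap (gM.symm : M →ₗ[k] M), ← hconj, LinearEquiv.charpoly_conj]
end

section
/- Let p be an odd prime, V a finite-dimensional ℚ_p-vector space with a nondegenerate symmetric bilinear form ⟨·,·⟩, and g a linear automorphism of V preserving the form. Let M ⊆ V be a ℤ_p-lattice with gM = M, M ⊆ M^∨ and p·M^∨ ⊆ M. Then Ω := M^∨/M is a finite-dimensional 𝔽_p-vector space carrying the well-defined symmetric bilinear form B̄(x̄, ȳ) := (p·⟨x,y⟩ mod p) and the automorphism ḡ induced by g. The assignment Λ ↦ Λ^∨/M defines a bijection from the set of ℤ_p-lattices Λ in V satisfying gΛ = Λ, pΛ ⊆ Λ^∨ ⊆ Λ, and Λ ⊆ M^∨, onto the set of ḡ-invariant subspaces U ⊆ Ω that are totally isotropic for B̄. -/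
/-- The dual lattice `Λ^∨ = {x ∈ V : ⟨x, λ⟩ ∈ ℤ_p for all λ ∈ Λ}` of a `ℤ_p`-lattice `Λ`
in a `ℚ_p`-vector space `V` with bilinear form `B`. -/
def dualLattice {p : ℕ} [Fact p.Prime] {V : Type*} [AddCommGroup V] [Module ℚ_[p] V]
    [Module ℤ_[p] V] [IsScalarTower ℤ_[p] ℚ_[p] V]
    (B : LinearMap.BilinForm ℚ_[p] V) (Λ : Submodule ℤ_[p] V) : Submodule ℤ_[p] V where
  carrier := {x | ∀ y ∈ Λ, ∃ a : ℤ_[p], (a : ℚ_[p]) = B x y}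
  add_mem' := by
    intro x₁ x₂ h₁ h₂ y hy
    obtain ⟨a₁, ha₁⟩ := h₁ y hy
    obtain ⟨a₂, ha₂⟩ := h₂ y hy
    exact ⟨a₁ + a₂, by rw [map_add, LinearMap.add_apply, ← ha₁, ← ha₂, PadicInt.coe_add]⟩
  zero_mem' := by
    intro y hy
    exact ⟨0, by simp⟩
  smul_mem' := by
    intro c x hx y hy
    obtain ⟨a, ha⟩ := hx y hy
    refine ⟨c * a, ?_⟩
    rw [← algebraMap_smul ℚ_[p] c x, map_smul, LinearMap.smul_apply, smul_eq_mul, ← ha,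
      PadicInt.algebraMap_apply]
    push_cast
    ring

section DualLattice

variable {p : ℕ} [Fact p.Prime] {V : Type*} [AddCommGroup V] [Module ℚ_[p] V]
  [Module ℤ_[p] V] [IsScalarTower ℤ_[p] ℚ_[p] V] {B : LinearMap.BilinForm ℚ_[p] V}

theorem mem_dualLattice {Λ : Submodule ℤ_[p] V} {x : V} :
    x ∈ dualLattice B Λ ↔ ∀ y ∈ Λ, ∃ a : ℤ_[p], (a : ℚ_[p]) = B x y := Iff.rfl

theorem dualLattice_eq_dualSubmodule (Λ : Submodule ℤ_[p] V) :
    dualLattice B Λ = B.dualSubmodule Λ := by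
  ext x
  simp only [mem_dualLattice, LinearMap.BilinForm.mem_dualSubmodule, Submodule.mem_one,
    PadicInt.algebraMap_apply]

theorem dualLattice_anti {Λ₁ Λ₂ : Submodule ℤ_[p] V} (h : Λ₁ ≤ Λ₂) :
    dualLattice B Λ₂ ≤ dualLattice B Λ₁ := fun _ hx y hy => hx y (h hy)

theorem le_dualLattice_comm (hsymm : ∀ x y : V, B x y = B y x) {Λ₁ Λ₂ : Submodule ℤ_[p] V}
    (h : Λ₁ ≤ dualLattice B Λ₂) : Λ₂ ≤ dualLattice B Λ₁ := fun x hx y hy => by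
  rw [hsymm]
  exact h hy x hx

theorem map_dualLattice {g : V ≃ₗ[ℚ_[p]] V} (hg : ∀ x y : V, B (g x) (g y) = B x y)
    (Λ : Submodule ℤ_[p] V) :
    (dualLattice B Λ).map ((g : V →ₗ[ℚ_[p]] V).restrictScalars ℤ_[p]) =
      dualLattice B (Λ.map ((g : V →ₗ[ℚ_[p]] V).restrictScalars ℤ_[p])) := by
  ext x
  obtain ⟨x, rfl⟩ := g.surjective x
  simp [Submodule.mem_map, mem_dualLattice, hg]

theorem exists_basis_span_eq_of_lattice {Λ : Submodule ℤ_[p] V} (hfg : Λ.FG)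
    (hspan : Submodule.span ℚ_[p] (Λ : Set V) = ⊤) :
    ∃ (ι : Type) (_ : Finite ι) (b : Module.Basis ι ℚ_[p] V),
      Submodule.span ℤ_[p] (Set.range b) = Λ := by
  have : Submodule.IsLattice ℚ_[p] Λ := ⟨hfg, hspan⟩
  have : Module.Free ℤ_[p] Λ := Submodule.IsLattice.free ℚ_[p] Λ
  let b := Module.finBasis ℤ_[p] Λ
  refine ⟨_, inferInstance, b.extendOfIsLattice ℚ_[p], ?_⟩
  have h : ⇑(b.extendOfIsLattice ℚ_[p]) = Λ.subtype ∘ b := by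
    ext i
    simp
  rw [h, Set.range_comp, Submodule.span_image, b.span_eq, Submodule.map_top,
    Submodule.range_subtype]

theorem dualLattice_dualLattice (hsymm : ∀ x y : V, B x y = B y x) (hnondeg : B.Nondegenerate)
    {Λ : Submodule ℤ_[p] V} (hfg : Λ.FG) (hspan : Submodule.span ℚ_[p] (Λ : Set V) = ⊤) :
    dualLattice B (dualLattice B Λ) = Λ := by
  obtain ⟨ι, _, b, rfl⟩ := exists_basis_span_eq_of_lattice hfg hspan
  rw [dualLattice_eq_dualSubmodule, dualLattice_eq_dualSubmodule]
  exact B.dualSubmodule_dualSubmodule_of_basis hnondeg ⟨hsymm⟩ b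

theorem dualLattice_fg (hnondeg : B.Nondegenerate)
    {Λ : Submodule ℤ_[p] V} (hfg : Λ.FG) (hspan : Submodule.span ℚ_[p] (Λ : Set V) = ⊤) :
    (dualLattice B Λ).FG := by
  classical
  obtain ⟨ι, _, b, rfl⟩ := exists_basis_span_eq_of_lattice hfg hspan
  rw [dualLattice_eq_dualSubmodule, B.dualSubmodule_span_of_basis hnondeg b]
  exact Submodule.fg_span (Set.finite_range _)

end DualLattice

/-- Let `p` be an odd prime, `V` a finite-dimensional `ℚ_p`-vector space with a nondegenerate
symmetric bilinear form `B`, and `g` an automorphism of `V` preserving `B`.  Let `M` be a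
`ℤ_p`-lattice with `gM = M`, `M ⊆ M^∨` and `p·M^∨ ⊆ M`.  Then (in terms of the
`𝔽_p`-vector space `Ω = M^∨/M`, whose `ḡ`-invariant subspaces totally isotropic for the
induced form `B̄ = (p⟨·,·⟩ mod p)` correspond exactly to the intermediate lattices
`M ⊆ N ⊆ M^∨` with `gN = N` on which `⟨·,·⟩` is `ℤ_p`-valued, via `U = N/M`) the
assignment `Λ ↦ Λ^∨` (i.e. `Λ ↦ Λ^∨/M` on the quotient) is a bijection from the set of
lattices `Λ` with `gΛ = Λ`, `pΛ ⊆ Λ^∨ ⊆ Λ` and `Λ ⊆ M^∨` onto that set of intermediate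
lattices. -/
theorem stmt_11 (p : ℕ) [Fact p.Prime] (hodd : p ≠ 2)
    {V : Type*} [AddCommGroup V] [Module ℚ_[p] V] [FiniteDimensional ℚ_[p] V]
    [Module ℤ_[p] V] [IsScalarTower ℤ_[p] ℚ_[p] V]
    (B : LinearMap.BilinForm ℚ_[p] V) (hsymm : ∀ x y : V, B x y = B y x)
    (hnondeg : B.Nondegenerate)
    (g : V ≃ₗ[ℚ_[p]] V) (hg : ∀ x y : V, B (g x) (g y) = B x y)
    (M : Submodule ℤ_[p] V) (hMfg : M.FG)
    (hMspan : Submodule.span ℚ_[p] (M : Set V) = ⊤)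
    (hgM : Submodule.map ((g : V →ₗ[ℚ_[p]] V).restrictScalars ℤ_[p]) M = M)
    (hMsub : M ≤ dualLattice B M)
    (hpMd : ∀ x ∈ dualLattice B M, (p : ℤ_[p]) • x ∈ M) :
    Set.BijOn (fun Λ => dualLattice B Λ)
      {Λ : Submodule ℤ_[p] V | Λ.FG ∧ Submodule.span ℚ_[p] (Λ : Set V) = ⊤ ∧
        Submodule.map ((g : V →ₗ[ℚ_[p]] V).restrictScalars ℤ_[p]) Λ = Λ ∧
        (∀ x ∈ Λ, (p : ℤ_[p]) • x ∈ dualLattice B Λ) ∧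
        dualLattice B Λ ≤ Λ ∧ Λ ≤ dualLattice B M}
      {N : Submodule ℤ_[p] V | M ≤ N ∧ N ≤ dualLattice B M ∧
        Submodule.map ((g : V →ₗ[ℚ_[p]] V).restrictScalars ℤ_[p]) N = N ∧
        ∀ x ∈ N, ∀ y ∈ N, ∃ a : ℤ_[p], (a : ℚ_[p]) = B x y} := by
  have hfg_of_le {N : Submodule ℤ_[p] V} (h : N ≤ dualLattice B M) : N.FG :=
    (dualLattice_fg hnondeg hMfg hMspan).of_le h
  have hspan_of_le {N : Submodule ℤ_[p] V} (h : M ≤ N) :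
      Submodule.span ℚ_[p] (N : Set V) = ⊤ :=
    eq_top_iff.2 (hMspan ▸ Submodule.span_mono h)
  refine ⟨?_, ?_, ?_⟩
  · rintro Λ ⟨-, -, hgΛ, -, hdual, hΛ⟩
    exact ⟨le_dualLattice_comm hsymm hΛ, hdual.trans hΛ, by rw [map_dualLattice hg, hgΛ],
      fun x hx y hy => hx y (hdual hy)⟩
  · rintro Λ₁ ⟨hfg₁, hspan₁, -⟩ Λ₂ ⟨hfg₂, hspan₂, -⟩ h
    rw [← dualLattice_dualLattice hsymm hnondeg hfg₁ hspan₁,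
      ← dualLattice_dualLattice hsymm hnondeg hfg₂ hspan₂]
    exact congrArg (dualLattice B) h
  · rintro N ⟨hMN, hN, hgN, hint⟩
    have hdd := dualLattice_dualLattice hsymm hnondeg (hfg_of_le hN) (hspan_of_le hMN)
    have hle : N ≤ dualLattice B N := hint
    have hanti := dualLattice_anti (B := B) hMN
    refine ⟨dualLattice B N, ⟨hfg_of_le hanti, hspan_of_le (hMN.trans hle),
      by rw [map_dualLattice hg, hgN], fun x hx => ?_, hdd.le.trans hle, hanti⟩, hdd⟩
    exact hdd.ge (hMN (hpMd x (hanti hx)))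
end
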